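/- Let d ≥ 1 and let u ∈ H²(ℝ^d) be a solution of Δu + Vu = 0 on ℝ^d with ‖V‖_{L^∞} ≤ L, ∫_{|x|<1} |u(x)|² dx ≥ 1, and ∫_{ℝ^d} (|u(x)|² + |∇u(x)|²) dx ≤ A². Then there exists c = c(L, A) > 0 such that for all sufficiently large R, λ(R) := (∫_{R−1<|x|<R} (|u(x)|² + |∇u(x)|²) dx)^{1/2} ≥ c e^{−c R^{4/3}}. -/

import Mathlib

open MeasureTheory

/-- The Laplacian `Δu = Σ_k ∂²u/∂x_k²` of a function on `ℝ^d`. -/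
noncomputable def lapR {d : ℕ} (u : EuclideanSpace ℝ (Fin d) → ℂ)
    (x : EuclideanSpace ℝ (Fin d)) : ℂ :=
  ∑ k, fderiv ℝ (fun y => fderiv ℝ u y (EuclideanSpace.single k 1)) x
    (EuclideanSpace.single k 1)

/-- The partial derivative of `f` in the `k`-th coordinate direction. -/
noncomputable def partialDeriv {d : ℕ} {F : Type*} [NormedAddCommGroup F] [NormedSpace ℝ F]
    (k : Fin d) (f : EuclideanSpace ℝ (Fin d) → F) (x : EuclideanSpace ℝ (Fin d)) : F :=
  fderiv ℝ f x (EuclideanSpace.single k 1)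

section PartialDeriv

variable {d : ℕ} {F : Type*} [NormedAddCommGroup F] [NormedSpace ℝ F]

theorem ContDiff.partialDeriv {f : EuclideanSpace ℝ (Fin d) → F} {m n : ℕ∞}
    (hf : ContDiff ℝ n f) (hmn : m + 1 ≤ n) (k : Fin d) : ContDiff ℝ m (partialDeriv k f) := by
  have h : ContDiff ℝ m (fderiv ℝ f) := hf.fderiv_right (by exact_mod_cast hmn)
  exact h.clm_apply contDiff_const

theorem HasCompactSupport.partialDeriv {f : EuclideanSpace ℝ (Fin d) → F}
    (hf : HasCompactSupport f) (k : Fin d) : HasCompactSupport (partialDeriv k f) :=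
  hf.fderiv_apply ℝ _

theorem partialDeriv_mul {f g : EuclideanSpace ℝ (Fin d) → ℝ} {x : EuclideanSpace ℝ (Fin d)}
    (k : Fin d) (hf : DifferentiableAt ℝ f x) (hg : DifferentiableAt ℝ g x) :
    partialDeriv k (fun y => f y * g y) x = partialDeriv k f x * g x + f x * partialDeriv k g x := by
  simp only [partialDeriv, fderiv_fun_mul hf hg]
  simp
  ring

theorem partialDeriv_add {f g : EuclideanSpace ℝ (Fin d) → F} {x : EuclideanSpace ℝ (Fin d)}
    (k : Fin d) (hf : DifferentiableAt ℝ f x) (hg : DifferentiableAt ℝ g x) :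
    partialDeriv k (fun y => f y + g y) x = partialDeriv k f x + partialDeriv k g x := by
  simp [partialDeriv, fderiv_fun_add hf hg]

theorem partialDeriv_const_mul {f : EuclideanSpace ℝ (Fin d) → ℝ} {x : EuclideanSpace ℝ (Fin d)}
    (k : Fin d) (c : ℝ) (hf : DifferentiableAt ℝ f x) :
    partialDeriv k (fun y => c * f y) x = c * partialDeriv k f x := by
  simp [partialDeriv, fderiv_const_mul hf]

theorem partialDeriv_sum {ι : Type*} (s : Finset ι) {f : ι → EuclideanSpace ℝ (Fin d) → F}
    {x : EuclideanSpace ℝ (Fin d)} (k : Fin d) (hf : ∀ j ∈ s, DifferentiableAt ℝ (f j) x) :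
    partialDeriv k (fun y => ∑ j ∈ s, f j y) x = ∑ j ∈ s, partialDeriv k (f j) x := by
  simp [partialDeriv, fderiv_fun_sum hf]

theorem partialDeriv_comp {h : ℝ → ℝ} {f : EuclideanSpace ℝ (Fin d) → ℝ}
    {x : EuclideanSpace ℝ (Fin d)} (k : Fin d) (hh : DifferentiableAt ℝ h (f x))
    (hf : DifferentiableAt ℝ f x) :
    partialDeriv k (fun y => h (f y)) x = deriv h (f x) * partialDeriv k f x := by
  have := (hh.hasDerivAt.comp_hasFDerivAt x hf.hasFDerivAt).fderiv
  simp only [partialDeriv]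
  rw [show (fun y => h (f y)) = h ∘ f from rfl, this]
  simp

theorem partialDeriv_apply_add_const (k i : Fin d) (b : ℝ) (x : EuclideanSpace ℝ (Fin d)) :
    partialDeriv k (fun y : EuclideanSpace ℝ (Fin d) => y i + b) x = if k = i then 1 else 0 := by
  have : HasFDerivAt (fun y : EuclideanSpace ℝ (Fin d) => y i + b)
      (EuclideanSpace.proj i : EuclideanSpace ℝ (Fin d) →L[ℝ] ℝ) x :=
    (EuclideanSpace.proj i : EuclideanSpace ℝ (Fin d) →L[ℝ] ℝ).hasFDerivAt.add_const b
  simp only [partialDeriv, this.fderiv]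
  simp [eq_comm]

theorem partialDeriv_comm {f : EuclideanSpace ℝ (Fin d) → F} (hf : ContDiff ℝ 2 f) (j k : Fin d)
    (x : EuclideanSpace ℝ (Fin d)) :
    partialDeriv j (partialDeriv k f) x = partialDeriv k (partialDeriv j f) x := by
  have hs : IsSymmSndFDerivAt ℝ f x := hf.contDiffAt.isSymmSndFDerivAt (by simp)
  have hd : DifferentiableAt ℝ (fderiv ℝ f) x :=
    ((hf.fderiv_right (m := 1) (by norm_num)).differentiable (by norm_num)) x
  have key : ∀ a b : Fin d, partialDeriv a (partialDeriv b f) x =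
      fderiv ℝ (fderiv ℝ f) x (EuclideanSpace.single a 1) (EuclideanSpace.single b 1) := by
    intro a b
    simp only [partialDeriv]
    rw [show partialDeriv b f = fun y => fderiv ℝ f y (EuclideanSpace.single b 1) from rfl,
      fderiv_clm_apply hd (by fun_prop)]
    simp
  rw [key, key]
  exact hs _ _

theorem integral_partialDeriv_eq_zero {f : EuclideanSpace ℝ (Fin d) → ℝ} (hf : ContDiff ℝ 1 f)
    (hc : HasCompactSupport f) (k : Fin d) : ∫ x, partialDeriv k f x = 0 := by
  have h1 : Continuous (partialDeriv k f) := (hf.partialDeriv (m := 0) (by simp) k).continuous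
  have := integral_mul_fderiv_eq_neg_fderiv_mul_of_integrable (μ := volume)
    (f := fun _ : EuclideanSpace ℝ (Fin d) => (1 : ℝ)) (g := f) (v := EuclideanSpace.single k 1)
    (by simp) (by simpa [partialDeriv] using! h1.integrable_of_hasCompactSupport (hc.partialDeriv k))
    (by simpa using hf.continuous.integrable_of_hasCompactSupport hc)
    (by intros; fun_prop) (fun x _ => hf.differentiable (by norm_num) x)
  simpa [partialDeriv] using this

/-- The Laplacian of a real-valued function. -/
noncomputable def lap (f : EuclideanSpace ℝ (Fin d) → ℝ) (x : EuclideanSpace ℝ (Fin d)) : ℝ :=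
  ∑ k, partialDeriv k (partialDeriv k f) x

theorem ContDiff.continuous_lap {f : EuclideanSpace ℝ (Fin d) → ℝ} (hf : ContDiff ℝ 2 f) :
    Continuous (lap f) :=
  continuous_finsetSum _ fun k _ =>
    ((hf.partialDeriv (m := 1) (by norm_num) k).partialDeriv (n := 1) (m := 0) (by simp) k).continuous

theorem HasCompactSupport.lap {f : EuclideanSpace ℝ (Fin d) → ℝ} (hf : HasCompactSupport f) :
    HasCompactSupport (lap f) := by
  refine HasCompactSupport.of_support_subset_isCompact hf ?_
  intro x hx
  by_contra hxn
  apply hx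
  refine Finset.sum_eq_zero fun k _ => ?_
  have h1 : tsupport (_root_.partialDeriv k (_root_.partialDeriv k f)) ⊆ tsupport f :=
    (tsupport_fderiv_apply_subset ℝ _).trans
      (tsupport_fderiv_apply_subset (f := f) ℝ (EuclideanSpace.single k 1))
  exact image_eq_zero_of_notMem_tsupport fun h => hxn (h1 h)

theorem lap_mul {f g : EuclideanSpace ℝ (Fin d) → ℝ} (hf : ContDiff ℝ 2 f) (hg : ContDiff ℝ 2 g)
    (x : EuclideanSpace ℝ (Fin d)) :
    lap (fun y => f y * g y) x =
      f x * lap g x + 2 * ∑ k, partialDeriv k f x * partialDeriv k g x + g x * lap f x := by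
  have hfd : Differentiable ℝ f := hf.differentiable (by norm_num)
  have hgd : Differentiable ℝ g := hg.differentiable (by norm_num)
  have hf' : ∀ k, Differentiable ℝ (partialDeriv k f) := fun k =>
    (hf.partialDeriv (m := 1) (by norm_num) k).differentiable (by norm_num)
  have hg' : ∀ k, Differentiable ℝ (partialDeriv k g) := fun k =>
    (hg.partialDeriv (m := 1) (by norm_num) k).differentiable (by norm_num)
  simp only [lap, Finset.mul_sum, ← Finset.sum_add_distrib]
  refine Finset.sum_congr rfl fun k _ => ?_
  have h1 : partialDeriv k (fun y => f y * g y) =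
      fun y => partialDeriv k f y * g y + f y * partialDeriv k g y :=
    funext fun y => partialDeriv_mul k (hfd y) (hgd y)
  rw [h1, partialDeriv_add k ((hf' k x).fun_mul (hgd x)) ((hfd x).fun_mul (hg' k x)),
    partialDeriv_mul k (hf' k x) (hgd x), partialDeriv_mul k (hfd x) (hg' k x)]
  ring

end PartialDeriv

section Carleman

variable {d : ℕ}

theorem lap_add_sub_mul_sq_ge {v : EuclideanSpace ℝ (Fin d) → ℝ} (hv : ContDiff ℝ 2 v)
    (i : Fin d) (b : ℝ) {τ : ℝ} (hτ : 0 ≤ τ) (x : EuclideanSpace ℝ (Fin d)) :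
    4 * τ ^ 3 * ((x i + b) ^ 2 * v x ^ 2) ≤
      (lap v x + τ ^ 2 * (x i + b) ^ 2 * v x
        - τ * (2 * ((x i + b) * partialDeriv i v x) + v x)) ^ 2 +
      (2 * τ * (∑ k, partialDeriv k (fun y =>
          partialDeriv k v y * (2 * ((y i + b) * partialDeriv i v y) + v y)) x) +
        (-(2 * τ)) * partialDeriv i (fun y => (y i + b) * ∑ j, partialDeriv j v y * partialDeriv j v y) x +
        2 * τ ^ 3 * partialDeriv i (fun y =>
          ((y i + b) * (y i + b)) * ((y i + b) * (v y * v y))) x) := by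
  have hvd : Differentiable ℝ v := hv.differentiable (by norm_num)
  have hv' : ∀ k, Differentiable ℝ (partialDeriv k v) := fun k =>
    (hv.partialDeriv (m := 1) (by norm_num) k).differentiable (by norm_num)
  have hs : Differentiable ℝ (fun y : EuclideanSpace ℝ (Fin d) => y i + b) := by fun_prop
  have hG : ∀ k, partialDeriv k (fun y =>
      partialDeriv k v y * (2 * ((y i + b) * partialDeriv i v y) + v y)) x =
      partialDeriv k (partialDeriv k v) x * (2 * ((x i + b) * partialDeriv i v x) + v x) +
      ((if k = i then 2 * (partialDeriv i v x * partialDeriv i v x) else 0) +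
        2 * (x i + b) * (partialDeriv k v x * partialDeriv i (partialDeriv k v) x) +
        partialDeriv k v x * partialDeriv k v x) := by
    intro k
    rw [partialDeriv_mul k (hv' k x) ((((hs x).fun_mul (hv' i x)).const_mul 2).fun_add (hvd x)),
      partialDeriv_add k (((hs x).fun_mul (hv' i x)).const_mul 2) (hvd x),
      partialDeriv_const_mul k 2 ((hs x).fun_mul (hv' i x)),
      partialDeriv_mul k (hs x) (hv' i x), partialDeriv_apply_add_const, partialDeriv_comm hv k i]
    split_ifs with h
    · subst h; ring
    · ring
  have hH : partialDeriv i (fun y => (y i + b) * ∑ j, partialDeriv j v y * partialDeriv j v y) x =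
      (∑ j, partialDeriv j v x * partialDeriv j v x) +
        2 * (x i + b) * ∑ j, partialDeriv j v x * partialDeriv i (partialDeriv j v) x := by
    rw [partialDeriv_mul i (hs x)
      (DifferentiableAt.fun_sum fun j _ => (hv' j x).fun_mul (hv' j x)),
      partialDeriv_sum _ _ (fun j _ => (hv' j x).fun_mul (hv' j x)), partialDeriv_apply_add_const]
    simp only [partialDeriv_mul i (hv' _ x) (hv' _ x), if_true, one_mul, Finset.mul_sum]
    congr 1
    exact Finset.sum_congr rfl fun j _ => by ring
  have hT : partialDeriv i (fun y => ((y i + b) * (y i + b)) * ((y i + b) * (v y * v y))) x =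
      3 * (x i + b) ^ 2 * v x ^ 2 + 2 * (x i + b) ^ 3 * (v x * partialDeriv i v x) := by
    rw [partialDeriv_mul i ((hs x).fun_mul (hs x)) ((hs x).fun_mul ((hvd x).fun_mul (hvd x))),
      partialDeriv_mul i (hs x) (hs x), partialDeriv_mul i (hs x) ((hvd x).fun_mul (hvd x)),
      partialDeriv_mul i (hvd x) (hvd x), partialDeriv_apply_add_const]
    simp only [if_true]
    ring
  have hGsum : (∑ k, partialDeriv k (fun y =>
      partialDeriv k v y * (2 * ((y i + b) * partialDeriv i v y) + v y)) x) =
      lap v x * (2 * ((x i + b) * partialDeriv i v x) + v x) +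
      (2 * (partialDeriv i v x * partialDeriv i v x) +
        2 * (x i + b) * (∑ k, partialDeriv k v x * partialDeriv i (partialDeriv k v) x) +
        ∑ k, partialDeriv k v x * partialDeriv k v x) := by
    simp only [hG, Finset.sum_add_distrib, lap, Finset.sum_mul, Finset.mul_sum]
    simp
  rw [hGsum, hH, hT]
  have h1 := sq_nonneg (lap v x + τ ^ 2 * (x i + b) ^ 2 * v x)
  have h2 := sq_nonneg (τ * (2 * ((x i + b) * partialDeriv i v x) + v x))
  have h3 : 0 ≤ τ * (partialDeriv i v x) ^ 2 := by positivity
  generalize (∑ k, partialDeriv k v x * partialDeriv i (partialDeriv k v) x) = P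
  generalize (∑ k, partialDeriv k v x * partialDeriv k v x) = Q
  linear_combination h1 + h2 + 4 * h3

theorem integral_sq_lap_add_sub_ge {v : EuclideanSpace ℝ (Fin d) → ℝ} (hv : ContDiff ℝ 2 v)
    (hc : HasCompactSupport v) (i : Fin d) (b : ℝ) {τ : ℝ} (hτ : 0 ≤ τ) :
    4 * τ ^ 3 * ∫ x, (x i + b) ^ 2 * v x ^ 2 ≤
      ∫ x, (lap v x + τ ^ 2 * (x i + b) ^ 2 * v x
        - τ * (2 * ((x i + b) * partialDeriv i v x) + v x)) ^ 2 := by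
  have hv1 : ContDiff ℝ 1 v := hv.of_le (by norm_num)
  have hv' : ∀ k, ContDiff ℝ 1 (partialDeriv k v) := fun k =>
    hv.partialDeriv (m := 1) (by norm_num) k
  have hlap := hv.continuous_lap
  have hcoord : ContDiff ℝ 1 (fun y : EuclideanSpace ℝ (Fin d) => y i + b) :=
    (EuclideanSpace.proj i : EuclideanSpace ℝ (Fin d) →L[ℝ] ℝ).contDiff.add contDiff_const
  have hG : ∀ k, ContDiff ℝ 1 (fun y =>
      partialDeriv k v y * (2 * ((y i + b) * partialDeriv i v y) + v y)) := fun k =>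
    (hv' k).mul ((contDiff_const.mul (hcoord.mul (hv' i))).add hv1)
  have hGc : ∀ k, HasCompactSupport (fun y =>
      partialDeriv k v y * (2 * ((y i + b) * partialDeriv i v y) + v y)) := fun k =>
    (hc.partialDeriv k).mul_right
  have hH : ContDiff ℝ 1 (fun y : EuclideanSpace ℝ (Fin d) =>
      (y i + b) * ∑ j, partialDeriv j v y * partialDeriv j v y) :=
    hcoord.mul (ContDiff.sum fun j _ => (hv' j).mul (hv' j))
  have hHc : HasCompactSupport (fun y : EuclideanSpace ℝ (Fin d) =>
      (y i + b) * ∑ j, partialDeriv j v y * partialDeriv j v y) := by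
    refine HasCompactSupport.mul_left (HasCompactSupport.of_support_subset_isCompact hc ?_)
    intro x hx
    by_contra hxn
    refine hx (Finset.sum_eq_zero fun k _ => ?_)
    have : partialDeriv k v x = 0 := image_eq_zero_of_notMem_tsupport fun h =>
      hxn (tsupport_fderiv_apply_subset ℝ _ h)
    simp [this]
  have hT : ContDiff ℝ 1 (fun y : EuclideanSpace ℝ (Fin d) =>
      ((y i + b) * (y i + b)) * ((y i + b) * (v y * v y))) :=
    (hcoord.mul hcoord).mul (hcoord.mul (hv1.mul hv1))
  have hTc : HasCompactSupport (fun y : EuclideanSpace ℝ (Fin d) =>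
      ((y i + b) * (y i + b)) * ((y i + b) * (v y * v y))) :=
    (hc.mul_left.mul_left).mul_left
  have hint : ∀ {f : EuclideanSpace ℝ (Fin d) → ℝ}, ContDiff ℝ 1 f → HasCompactSupport f →
      ∀ k, Integrable (partialDeriv k f) := fun hf hfc k =>
    (hf.partialDeriv (m := 0) (by simp) k).continuous.integrable_of_hasCompactSupport
      (hfc.partialDeriv k)
  have iG := integrable_finsetSum Finset.univ fun k _ => hint (hG k) (hGc k) k
  have iH := hint hH hHc i
  have iT := hint hT hTc i
  have hvc := hv.continuous
  have hvic := (hv' i).continuous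
  have iS : Integrable (fun x : EuclideanSpace ℝ (Fin d) =>
      (lap v x + τ ^ 2 * (x i + b) ^ 2 * v x
        - τ * (2 * ((x i + b) * partialDeriv i v x) + v x)) ^ 2) := by
    refine Continuous.integrable_of_hasCompactSupport (by fun_prop) ?_
    have h1 := hc.lap
    have h2 := hc.partialDeriv i
    have : HasCompactSupport (fun x : EuclideanSpace ℝ (Fin d) =>
      (lap v x + τ ^ 2 * (x i + b) ^ 2 * v x
        - τ * (2 * ((x i + b) * partialDeriv i v x) + v x))) :=
      (h1.add hc.mul_left).sub (((h2.mul_left).mul_left.add hc).mul_left)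
    exact this.comp_left (g := fun t : ℝ => t ^ 2) (by norm_num)
  have iL : Integrable (fun x : EuclideanSpace ℝ (Fin d) => (x i + b) ^ 2 * v x ^ 2) := by
    refine Continuous.integrable_of_hasCompactSupport (by fun_prop) ?_
    exact HasCompactSupport.mul_left (hc.comp_left (g := fun t : ℝ => t ^ 2) (by norm_num))
  have iD1 := ((iG.const_mul (2 * τ)).add (iH.const_mul (-(2 * τ))))
  have iD := iD1.add (iT.const_mul (2 * τ ^ 3))
  have hmono := integral_mono (iL.const_mul (4 * τ ^ 3)) (iS.add iD)
    (fun x => lap_add_sub_mul_sq_ge hv i b hτ x)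
  rw [integral_const_mul, integral_add' iS iD, integral_add' iD1 (iT.const_mul (2 * τ ^ 3)),
    integral_add' (iG.const_mul (2 * τ)) (iH.const_mul (-(2 * τ))), integral_const_mul,
    integral_const_mul, integral_const_mul, integral_partialDeriv_eq_zero hH hHc,
    integral_partialDeriv_eq_zero hT hTc,
    integral_finsetSum _ (fun k _ => hint (hG k) (hGc k) k)] at hmono
  simpa only [integral_partialDeriv_eq_zero (hG _) (hGc _), Finset.sum_const_zero, mul_zero,
    add_zero] using hmono

/-- Carleman inequality with the weight `exp (τ (x_i + b)² / 2)`. -/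
theorem carleman_inequality {g : EuclideanSpace ℝ (Fin d) → ℝ} (hg : ContDiff ℝ 2 g)
    (hc : HasCompactSupport g) (i : Fin d) (b : ℝ) {τ : ℝ} (hτ : 0 ≤ τ) :
    4 * τ ^ 3 * ∫ x, Real.exp (τ * (x i + b) ^ 2) * ((x i + b) ^ 2 * g x ^ 2) ≤
      ∫ x, Real.exp (τ * (x i + b) ^ 2) * lap g x ^ 2 := by
  have hcoord : ContDiff ℝ 2 (fun y : EuclideanSpace ℝ (Fin d) => y i + b) :=
    (EuclideanSpace.proj i : EuclideanSpace ℝ (Fin d) →L[ℝ] ℝ).contDiff.add contDiff_const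
  let ψ : EuclideanSpace ℝ (Fin d) → ℝ := fun y => Real.exp (τ / 2 * (y i + b) ^ 2)
  have hψ : ContDiff ℝ 2 ψ := (contDiff_const.mul (hcoord.pow 2)).exp
  have hψ2 : ∀ x, ψ x ^ 2 = Real.exp (τ * (x i + b) ^ 2) := by
    intro x
    simp only [ψ, ← Real.exp_nat_mul]
    congr 1
    push_cast
    ring
  have hsd : Differentiable ℝ (fun y : EuclideanSpace ℝ (Fin d) => y i + b) :=
    hcoord.differentiable (by norm_num)
  have hψd : Differentiable ℝ ψ := hψ.differentiable (by norm_num)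
  have hψ' : ∀ k, partialDeriv k ψ = fun x => if k = i then τ * ((x i + b) * ψ x) else 0 := by
    intro k
    funext x
    have hd : HasDerivAt (fun t : ℝ => Real.exp (τ / 2 * t ^ 2))
        (Real.exp (τ / 2 * (x i + b) ^ 2) * (τ / 2 * (2 * (x i + b)))) (x i + b) := by
      have := (((hasDerivAt_pow 2 (x i + b)).const_mul (τ / 2))).exp
      simpa using this
    rw [show ψ = fun y : EuclideanSpace ℝ (Fin d) =>
        (fun t : ℝ => Real.exp (τ / 2 * t ^ 2)) (y i + b) from rfl,
      partialDeriv_comp (h := fun t : ℝ => Real.exp (τ / 2 * t ^ 2)) (f := fun y => y i + b)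
        k hd.differentiableAt (hsd x), hd.deriv, partialDeriv_apply_add_const]
    split_ifs
    · simp only; ring
    · ring
  have hlapψ : ∀ x, lap ψ x = (τ + τ ^ 2 * (x i + b) ^ 2) * ψ x := by
    intro x
    rw [lap, Finset.sum_eq_single i]
    · rw [hψ' i]
      simp only [if_true]
      rw [partialDeriv_const_mul i τ ((hsd x).fun_mul (hψd x)), partialDeriv_mul i (hsd x) (hψd x),
        partialDeriv_apply_add_const, hψ' i]
      simp only [if_true]
      ring
    · intro k _ hk
      rw [hψ' k]
      simp [hk, partialDeriv]
    · simp
  have key := integral_sq_lap_add_sub_ge (hψ.mul hg) (hc.mul_left (f := ψ)) i b hτ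
  refine le_of_eq_of_le ?_ (key.trans_eq ?_)
  · congr 2
    funext x
    rw [← hψ2]
    ring
  · congr 1
    funext x
    have e1 : partialDeriv i (fun y => ψ y * g y) x = τ * ((x i + b) * ψ x) * g x
        + ψ x * partialDeriv i g x := by
      rw [partialDeriv_mul i (hψd x) (hg.differentiable (by norm_num) x), hψ' i]
      simp
    rw [lap_mul hψ hg, e1, hlapψ, ← hψ2, ← mul_pow]
    have e2 : ∑ k, partialDeriv k ψ x * partialDeriv k g x =
        τ * ((x i + b) * ψ x) * partialDeriv i g x := by
      simp [hψ']
    rw [e2]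
    ring

end Carleman

section Cutoff

theorem deriv_eq_zero_of_Iio_of_Ioi {f : ℝ → ℝ} (hf : Continuous (deriv f)) {a b y z : ℝ}
    (ha : ∀ t < a, f t = y) (hb : ∀ t > b, f t = z) {t : ℝ} (ht : t ∉ Set.Ioo a b) :
    deriv f t = 0 := by
  have hcl : IsClosed {t | deriv f t = 0} := isClosed_eq hf continuous_const
  rcases le_or_gt t a with h | h
  · have hs : Set.Iio a ⊆ {t | deriv f t = 0} := fun s hs => by
      have : f =ᶠ[nhds s] fun _ => y := by
        filter_upwards [isOpen_Iio.mem_nhds hs] with r hr using ha r hr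
      simp [this.deriv_eq]
    have := hcl.closure_subset_iff.2 hs
    rw [closure_Iio] at this
    exact this h
  · have h' : b ≤ t := not_lt.1 fun hlt => ht ⟨h, hlt⟩
    have hs : Set.Ioi b ⊆ {t | deriv f t = 0} := fun s hs => by
      have : f =ᶠ[nhds s] fun _ => z := by
        filter_upwards [isOpen_Ioi.mem_nhds hs] with r hr using hb r hr
      simp [this.deriv_eq]
    have := hcl.closure_subset_iff.2 hs
    rw [closure_Ioi] at this
    exact this h'

theorem contDiff_deriv_smoothTransition : ContDiff ℝ 1 (deriv Real.smoothTransition) :=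
  (contDiff_succ_iff_deriv.1 (Real.smoothTransition.contDiff (n := 2))).2.2

theorem deriv_smoothTransition_eq_zero {t : ℝ} (ht : t ∉ Set.Ioo (0 : ℝ) 1) :
    deriv Real.smoothTransition t = 0 :=
  deriv_eq_zero_of_Iio_of_Ioi contDiff_deriv_smoothTransition.continuous
    (fun _ h => Real.smoothTransition.zero_of_nonpos h.le)
    (fun _ h => Real.smoothTransition.one_of_one_le (le_of_lt h)) ht

theorem deriv_deriv_smoothTransition_eq_zero {t : ℝ} (ht : t ∉ Set.Ioo (0 : ℝ) 1) :
    deriv (deriv Real.smoothTransition) t = 0 :=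
  deriv_eq_zero_of_Iio_of_Ioi (contDiff_deriv_smoothTransition.continuous_deriv (by norm_num))
    (fun _ h => deriv_smoothTransition_eq_zero fun h' => h.not_gt h'.1)
    (fun _ h => deriv_smoothTransition_eq_zero fun h' => (lt_asymm h h'.2)) ht

theorem exists_bound_deriv_smoothTransition :
    ∃ M : ℝ, ∀ t, |deriv Real.smoothTransition t| ≤ M ∧
      |deriv (deriv Real.smoothTransition) t| ≤ M := by
  obtain ⟨M₁, h₁⟩ := isCompact_Icc.exists_bound_of_continuousOn (s := Set.Icc (0 : ℝ) 1)
    contDiff_deriv_smoothTransition.continuous.continuousOn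
  obtain ⟨M₂, h₂⟩ := isCompact_Icc.exists_bound_of_continuousOn (s := Set.Icc (0 : ℝ) 1)
    (contDiff_deriv_smoothTransition.continuous_deriv (by norm_num)).continuousOn
  refine ⟨max 0 (max M₁ M₂), fun t => ?_⟩
  by_cases ht : t ∈ Set.Ioo (0 : ℝ) 1
  · have ht' := Set.Ioo_subset_Icc_self ht
    exact ⟨(h₁ t ht').trans (by simp), (h₂ t ht').trans (by simp)⟩
  · simp [deriv_smoothTransition_eq_zero ht, deriv_deriv_smoothTransition_eq_zero ht]

variable {d : ℕ}

/-- A radial cutoff, equal to `1` for `‖x‖ ≤ R - 1` and to `0` for `R ≤ ‖x‖`. -/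
noncomputable def radialCutoff (R : ℝ) (x : EuclideanSpace ℝ (Fin d)) : ℝ :=
  Real.smoothTransition ((2 * R - 1)⁻¹ * (R ^ 2 - ‖x‖ ^ 2))

theorem contDiff_radialCutoff (R : ℝ) :
    ContDiff ℝ 2 (radialCutoff R : EuclideanSpace ℝ (Fin d) → ℝ) :=
  (Real.smoothTransition.contDiff (n := 2)).comp
    (contDiff_const.mul (contDiff_const.sub (contDiff_norm_sq ℝ)))

theorem radialCutoff_eq_one {R : ℝ} (hR : 1 ≤ R) {x : EuclideanSpace ℝ (Fin d)}
    (hx : ‖x‖ ≤ R - 1) : radialCutoff R x = 1 := by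
  refine Real.smoothTransition.one_of_one_le ?_
  rw [inv_mul_eq_div, le_div_iff₀ (by linarith)]
  nlinarith [norm_nonneg x]

theorem radialCutoff_eq_zero {R : ℝ} (hR : 1 ≤ R) {x : EuclideanSpace ℝ (Fin d)}
    (hx : R ≤ ‖x‖) : radialCutoff R x = 0 := by
  refine Real.smoothTransition.zero_of_nonpos ?_
  exact mul_nonpos_of_nonneg_of_nonpos (inv_nonneg.2 (by linarith)) (by nlinarith)

theorem hasCompactSupport_radialCutoff {R : ℝ} (hR : 1 ≤ R) :
    HasCompactSupport (radialCutoff R : EuclideanSpace ℝ (Fin d) → ℝ) := by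
  refine HasCompactSupport.intro (isCompact_closedBall 0 R) fun x hx => ?_
  refine radialCutoff_eq_zero hR ?_
  simp only [Metric.mem_closedBall, dist_zero_right, not_le] at hx
  exact hx.le

theorem partialDeriv_mul_const_sub_norm_sq (k : Fin d) (c r : ℝ) (x : EuclideanSpace ℝ (Fin d)) :
    partialDeriv k (fun y : EuclideanSpace ℝ (Fin d) => c * (r - ‖y‖ ^ 2)) x
      = -2 * c * x k := by
  have h : HasFDerivAt (fun y : EuclideanSpace ℝ (Fin d) => c * (r - ‖y‖ ^ 2)) _ x :=
    ((hasStrictFDerivAt_norm_sq x).hasFDerivAt.const_sub r).const_mul c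
  rw [partialDeriv, h.fderiv]
  simp [EuclideanSpace.inner_single_right]
  ring

theorem sum_coord_mul_partialDeriv (f : EuclideanSpace ℝ (Fin d) → ℝ)
    (x : EuclideanSpace ℝ (Fin d)) : ∑ k, x k * partialDeriv k f x = fderiv ℝ f x x := by
  have hx : x = ∑ k, x k • EuclideanSpace.single k (1 : ℝ) := by
    have := (EuclideanSpace.basisFun (Fin d) ℝ).sum_repr x
    simpa using this.symm
  conv_rhs => rw [show fderiv ℝ f x x = fderiv ℝ f x (∑ k, x k • EuclideanSpace.single k (1 : ℝ))
    from by rw [← hx], map_sum]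
  simp [partialDeriv]

theorem partialDeriv_radialCutoff (k : Fin d) (R : ℝ) (x : EuclideanSpace ℝ (Fin d)) :
    partialDeriv k (radialCutoff R) x =
      deriv Real.smoothTransition ((2 * R - 1)⁻¹ * (R ^ 2 - ‖x‖ ^ 2)) *
        (-2 * (2 * R - 1)⁻¹ * x k) := by
  have hq : Differentiable ℝ (fun y : EuclideanSpace ℝ (Fin d) =>
      (2 * R - 1)⁻¹ * (R ^ 2 - ‖y‖ ^ 2)) :=
    ((contDiff_const.mul (contDiff_const.sub (contDiff_norm_sq ℝ))).differentiable
      (n := 1) (by norm_num))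
  rw [← partialDeriv_mul_const_sub_norm_sq k _ (R ^ 2) x]
  exact partialDeriv_comp k
    ((Real.smoothTransition.contDiff (n := 1)).differentiable (by norm_num) _) (hq x)

theorem lap_radialCutoff (R : ℝ) (x : EuclideanSpace ℝ (Fin d)) :
    lap (radialCutoff R) x =
      deriv (deriv Real.smoothTransition) ((2 * R - 1)⁻¹ * (R ^ 2 - ‖x‖ ^ 2)) *
        (4 * ((2 * R - 1)⁻¹) ^ 2 * ‖x‖ ^ 2) -
      deriv Real.smoothTransition ((2 * R - 1)⁻¹ * (R ^ 2 - ‖x‖ ^ 2)) *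
        (2 * d * (2 * R - 1)⁻¹) := by
  have hq : Differentiable ℝ (fun y : EuclideanSpace ℝ (Fin d) =>
      (2 * R - 1)⁻¹ * (R ^ 2 - ‖y‖ ^ 2)) :=
    ((contDiff_const.mul (contDiff_const.sub (contDiff_norm_sq ℝ))).differentiable
      (n := 1) (by norm_num))
  have hd : Differentiable ℝ (deriv Real.smoothTransition) :=
    contDiff_deriv_smoothTransition.differentiable (by norm_num)
  have hk : ∀ k, partialDeriv k (partialDeriv k (radialCutoff R)) x =
      deriv (deriv Real.smoothTransition) ((2 * R - 1)⁻¹ * (R ^ 2 - ‖x‖ ^ 2)) *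
        (4 * ((2 * R - 1)⁻¹) ^ 2 * (x k) ^ 2) -
      deriv Real.smoothTransition ((2 * R - 1)⁻¹ * (R ^ 2 - ‖x‖ ^ 2)) *
        (2 * (2 * R - 1)⁻¹) := by
    intro k
    have hc : Differentiable ℝ (fun y : EuclideanSpace ℝ (Fin d) => y k + 0) := by fun_prop
    have e : partialDeriv k (radialCutoff R) = fun y : EuclideanSpace ℝ (Fin d) =>
        deriv Real.smoothTransition ((2 * R - 1)⁻¹ * (R ^ 2 - ‖y‖ ^ 2)) *
          (-2 * (2 * R - 1)⁻¹ * (y k + 0)) := by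
      funext y
      rw [partialDeriv_radialCutoff, add_zero]
    have hdq : Differentiable ℝ (fun y : EuclideanSpace ℝ (Fin d) =>
        deriv Real.smoothTransition ((2 * R - 1)⁻¹ * (R ^ 2 - ‖y‖ ^ 2))) := hd.comp hq
    rw [e, partialDeriv_mul k (hdq x) ((hc x).const_mul _),
      partialDeriv_const_mul k _ (hc x), partialDeriv_apply_add_const,
      partialDeriv_comp (f := fun y : EuclideanSpace ℝ (Fin d) =>
        (2 * R - 1)⁻¹ * (R ^ 2 - ‖y‖ ^ 2)) k (hd _) (hq x), partialDeriv_mul_const_sub_norm_sq]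
    simp only [if_true]
    ring
  rw [lap]
  simp only [hk, Finset.sum_sub_distrib, ← Finset.mul_sum, EuclideanSpace.real_norm_sq_eq,
    Finset.sum_const, Finset.card_univ, Fintype.card_fin, nsmul_eq_mul]
  ring

theorem cutoff_arg_notMem_Ioo {R : ℝ} (hR : 1 ≤ R) {x : EuclideanSpace ℝ (Fin d)}
    (hx : ¬ (R - 1 < ‖x‖ ∧ ‖x‖ < R)) :
    (2 * R - 1)⁻¹ * (R ^ 2 - ‖x‖ ^ 2) ∉ Set.Ioo (0 : ℝ) 1 := by
  rintro ⟨h0, h1⟩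
  rw [inv_mul_eq_div] at h0 h1
  rw [div_lt_one (by linarith)] at h1
  rw [div_pos_iff_of_pos_right (by linarith)] at h0
  refine hx ⟨?_, ?_⟩ <;> nlinarith [norm_nonneg x]

theorem lap_radialCutoff_mul_of_not_annulus {R : ℝ} (hR : 1 ≤ R)
    {f : EuclideanSpace ℝ (Fin d) → ℝ} (hf : ContDiff ℝ 2 f) {x : EuclideanSpace ℝ (Fin d)}
    (hx : ¬ (R - 1 < ‖x‖ ∧ ‖x‖ < R)) :
    lap (fun y => radialCutoff R y * f y) x = radialCutoff R x * lap f x := by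
  have h := cutoff_arg_notMem_Ioo hR hx
  rw [lap_mul (contDiff_radialCutoff R) hf, lap_radialCutoff]
  simp [partialDeriv_radialCutoff, deriv_smoothTransition_eq_zero h,
    deriv_deriv_smoothTransition_eq_zero h]

theorem abs_lap_radialCutoff_mul_sub_le {R M : ℝ} (hR : 1 ≤ R)
    (hM : ∀ t, |deriv Real.smoothTransition t| ≤ M ∧
      |deriv (deriv Real.smoothTransition) t| ≤ M)
    {f : EuclideanSpace ℝ (Fin d) → ℝ} (hf : ContDiff ℝ 2 f) {x : EuclideanSpace ℝ (Fin d)}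
    (hx : ‖x‖ ≤ R) :
    |lap (fun y => radialCutoff R y * f y) x - radialCutoff R x * lap f x| ≤
      (4 + 2 * d) * M * (‖fderiv ℝ f x‖ + |f x|) := by
  have hinv : 0 ≤ (2 * R - 1)⁻¹ := inv_nonneg.2 (by linarith)
  have hone : (2 * R - 1)⁻¹ ≤ 1 := inv_le_one_of_one_le₀ (by linarith)
  have hxi : (2 * R - 1)⁻¹ * ‖x‖ ≤ 1 := by
    rw [inv_mul_le_iff₀ (by linarith)]
    linarith
  obtain ⟨h1, h2⟩ := hM ((2 * R - 1)⁻¹ * (R ^ 2 - ‖x‖ ^ 2))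
  have hMn : 0 ≤ M := (abs_nonneg _).trans h1
  have hgrad : 2 * ∑ k, partialDeriv k (radialCutoff R) x * partialDeriv k f x =
      -4 * (deriv Real.smoothTransition ((2 * R - 1)⁻¹ * (R ^ 2 - ‖x‖ ^ 2)) *
        ((2 * R - 1)⁻¹ * fderiv ℝ f x x)) := by
    rw [← sum_coord_mul_partialDeriv]
    simp only [partialDeriv_radialCutoff, Finset.mul_sum]
    exact Finset.sum_congr rfl fun k _ => by ring
  rw [lap_mul (contDiff_radialCutoff R) hf, lap_radialCutoff, hgrad]
  generalize deriv Real.smoothTransition ((2 * R - 1)⁻¹ * (R ^ 2 - ‖x‖ ^ 2)) = p at *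
  generalize deriv (deriv Real.smoothTransition) ((2 * R - 1)⁻¹ * (R ^ 2 - ‖x‖ ^ 2)) = r at *
  have hD : |(2 * R - 1)⁻¹ * fderiv ℝ f x x| ≤ ‖fderiv ℝ f x‖ := by
    rw [abs_mul, abs_of_nonneg hinv]
    calc (2 * R - 1)⁻¹ * |fderiv ℝ f x x| ≤ (2 * R - 1)⁻¹ * (‖fderiv ℝ f x‖ * ‖x‖) :=
          mul_le_mul_of_nonneg_left ((fderiv ℝ f x).le_opNorm x) hinv
      _ = ‖fderiv ℝ f x‖ * ((2 * R - 1)⁻¹ * ‖x‖) := by ring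
      _ ≤ ‖fderiv ℝ f x‖ * 1 := mul_le_mul_of_nonneg_left hxi (norm_nonneg _)
      _ = _ := mul_one _
  have hA : |-4 * (p * ((2 * R - 1)⁻¹ * fderiv ℝ f x x))| ≤ 4 * (M * ‖fderiv ℝ f x‖) := by
    rw [abs_mul, abs_mul p, show |(-4 : ℝ)| = 4 by norm_num]
    exact mul_le_mul_of_nonneg_left (mul_le_mul h1 hD (abs_nonneg _) hMn) (by norm_num)
  have hB : |r * (4 * (2 * R - 1)⁻¹ ^ 2 * ‖x‖ ^ 2)| ≤ M * 4 := by
    rw [abs_mul]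
    refine mul_le_mul h2 ?_ (abs_nonneg _) hMn
    rw [abs_of_nonneg (by positivity)]
    have : ((2 * R - 1)⁻¹ * ‖x‖) ^ 2 ≤ 1 := pow_le_one₀ (by positivity) hxi
    linarith [mul_pow (2 * R - 1)⁻¹ ‖x‖ 2]
  have hC : |p * (2 * d * (2 * R - 1)⁻¹)| ≤ M * (2 * d) := by
    rw [abs_mul]
    refine mul_le_mul h1 ?_ (abs_nonneg _) hMn
    rw [abs_of_nonneg (by positivity)]
    exact mul_le_of_le_one_right (by positivity) hone
  have hBC : |f x * (r * (4 * (2 * R - 1)⁻¹ ^ 2 * ‖x‖ ^ 2) - p * (2 * d * (2 * R - 1)⁻¹))| ≤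
      |f x| * (M * 4 + M * (2 * d)) := by
    rw [abs_mul]
    exact mul_le_mul_of_nonneg_left ((abs_sub _ _).trans (add_le_add hB hC)) (abs_nonneg _)
  have hdM : 0 ≤ 2 * d * M * ‖fderiv ℝ f x‖ := by positivity
  calc _ = |-4 * (p * ((2 * R - 1)⁻¹ * fderiv ℝ f x x)) +
        f x * (r * (4 * (2 * R - 1)⁻¹ ^ 2 * ‖x‖ ^ 2) - p * (2 * d * (2 * R - 1)⁻¹))| := by
        congr 1; ring
    _ ≤ _ := abs_add_le _ _
    _ ≤ _ := add_le_add hA hBC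
    _ ≤ _ := by linarith

end Cutoff

section LowerBound

variable {d : ℕ}

theorem lap_clm_comp (l : ℂ →L[ℝ] ℝ) {u : EuclideanSpace ℝ (Fin d) → ℂ} (hu : ContDiff ℝ 2 u)
    (x : EuclideanSpace ℝ (Fin d)) : lap (fun y => l (u y)) x = l (lapR u x) := by
  have h : ∀ (k : Fin d) {f : EuclideanSpace ℝ (Fin d) → ℂ}, Differentiable ℝ f →
      partialDeriv k (fun y => l (f y)) = fun y => l (partialDeriv k f y) := by
    intro k f hf
    funext y
    have := (l.hasFDerivAt.comp y (hf y).hasFDerivAt).fderiv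
    simp only [partialDeriv]
    rw [show (fun y => l (f y)) = l ∘ f from rfl, this]
    rfl
  rw [lap, show lapR u x = ∑ k, partialDeriv k (partialDeriv k u) x from rfl, map_sum]
  refine Finset.sum_congr rfl fun k _ => ?_
  rw [h k (hu.differentiable (by norm_num)),
    h k ((hu.partialDeriv (m := 1) (by norm_num) k).differentiable (by norm_num))]

theorem norm_fderiv_clm_comp_le {l : ℂ →L[ℝ] ℝ} (hl : ‖l‖ ≤ 1)
    {u : EuclideanSpace ℝ (Fin d) → ℂ} (hu : Differentiable ℝ u) (x : EuclideanSpace ℝ (Fin d)) :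
    ‖fderiv ℝ (fun y => l (u y)) x‖ ≤ ‖fderiv ℝ u x‖ := by
  have := (l.hasFDerivAt.comp x (hu x).hasFDerivAt).fderiv
  rw [show (fun y => l (u y)) = l ∘ u from rfl, this]
  exact (l.opNorm_comp_le _).trans (mul_le_of_le_one_left (norm_nonneg _) hl)

theorem sq_lap_radialCutoff_mul_le {R M : ℝ} (hR : 1 ≤ R)
    (hM : ∀ t, |deriv Real.smoothTransition t| ≤ M ∧
      |deriv (deriv Real.smoothTransition) t| ≤ M)
    {l : ℂ →L[ℝ] ℝ} (hl : ‖l‖ ≤ 1) {u : EuclideanSpace ℝ (Fin d) → ℂ} (hu : ContDiff ℝ 2 u)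
    (x : EuclideanSpace ℝ (Fin d)) :
    lap (fun y => radialCutoff R y * l (u y)) x ^ 2 ≤
      2 * (radialCutoff R x ^ 2 * (l (lapR u x)) ^ 2) +
      {x : EuclideanSpace ℝ (Fin d) | R - 1 < ‖x‖ ∧ ‖x‖ < R}.indicator
        (fun x => 4 * ((4 + 2 * d) * M) ^ 2 * (‖u x‖ ^ 2 + ‖fderiv ℝ u x‖ ^ 2)) x := by
  have hf : ContDiff ℝ 2 (fun y => l (u y)) := l.contDiff.comp hu
  by_cases hx : R - 1 < ‖x‖ ∧ ‖x‖ < R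
  · rw [Set.indicator_of_mem (by exact hx)]
    have h := abs_lap_radialCutoff_mul_sub_le hR hM hf hx.2.le
    have h1 := norm_fderiv_clm_comp_le hl (hu.differentiable (by norm_num)) x
    have h2 : |l (u x)| ≤ ‖u x‖ := (l.le_opNorm _).trans (mul_le_of_le_one_left (norm_nonneg _) hl)
    have hMn : 0 ≤ M := (abs_nonneg _).trans (hM 0).1
    have h3 := h.trans (mul_le_mul_of_nonneg_left (add_le_add h1 h2)
      (show 0 ≤ (4 + 2 * d) * M by positivity))
    rw [← lap_clm_comp l hu]
    generalize lap (fun y => radialCutoff R y * l (u y)) x = P at *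
    generalize lap (fun y => l (u y)) x = Q at *
    have h4 := sq_le_sq' (abs_le.1 h3).1 (abs_le.1 h3).2
    have h5 : ((4 + 2 * d) * M * (‖fderiv ℝ u x‖ + ‖u x‖)) ^ 2 ≤
        ((4 + 2 * d) * M) ^ 2 * (2 * (‖u x‖ ^ 2 + ‖fderiv ℝ u x‖ ^ 2)) := by
      rw [mul_pow]
      refine mul_le_mul_of_nonneg_left ?_ (by positivity)
      nlinarith [sq_nonneg (‖fderiv ℝ u x‖ - ‖u x‖)]
    nlinarith [sq_nonneg (P - 2 * (radialCutoff R x * Q))]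
  · rw [Set.indicator_of_notMem (by exact hx),
      lap_radialCutoff_mul_of_not_annulus hR hf hx, lap_clm_comp l hu, add_zero, mul_pow]
    nlinarith [mul_nonneg (sq_nonneg (radialCutoff R x)) (sq_nonneg (l (lapR u x)))]

theorem weight_mem_Icc {R τ : ℝ} (hτ : 0 ≤ τ) (i : Fin d) {x : EuclideanSpace ℝ (Fin d)}
    (hx : ‖x‖ ≤ R) :
    4 * R ^ 2 ≤ (x i + 3 * R) ^ 2 ∧
      Real.exp (τ * (x i + 3 * R) ^ 2) ≤ Real.exp (16 * (τ * R ^ 2)) := by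
  have h := abs_le.1 ((PiLp.norm_apply_le x i).trans hx)
  have hR : 0 ≤ R := (norm_nonneg x).trans hx
  refine ⟨by nlinarith, Real.exp_le_exp.2 ?_⟩
  have : (x i + 3 * R) ^ 2 ≤ 16 * R ^ 2 := by nlinarith
  nlinarith [mul_le_mul_of_nonneg_left this hτ]

theorem sq_norm_eq_re_sq_add_im_sq (z : ℂ) :
    ‖z‖ ^ 2 = Complex.reCLM z ^ 2 + Complex.imCLM z ^ 2 := by
  rw [Complex.sq_norm, Complex.normSq_apply]
  simp
  ring

theorem weighted_integral_le_annulus {R M L τ : ℝ} (hR : 1 ≤ R) (hτ : 0 ≤ τ)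
    (hM : ∀ t, |deriv Real.smoothTransition t| ≤ M ∧
      |deriv (deriv Real.smoothTransition) t| ≤ M)
    {u V : EuclideanSpace ℝ (Fin d) → ℂ} (hu : ContDiff ℝ 2 u)
    (hint : Integrable (fun x => ‖u x‖ ^ 2 + ‖fderiv ℝ u x‖ ^ 2))
    (heq : ∀ x, lapR u x + V x * u x = 0) (hV : ∀ x, ‖V x‖ ≤ L) (i : Fin d) :
    (16 * (τ ^ 3 * R ^ 2) - 2 * L ^ 2) *
        ∫ x, Real.exp (τ * (x i + 3 * R) ^ 2) * (radialCutoff R x ^ 2 * ‖u x‖ ^ 2) ≤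
      Real.exp (16 * (τ * R ^ 2)) * (8 * ((4 + 2 * d) * M) ^ 2) *
        ∫ x in {x : EuclideanSpace ℝ (Fin d) | R - 1 < ‖x‖ ∧ ‖x‖ < R},
          (‖u x‖ ^ 2 + ‖fderiv ℝ u x‖ ^ 2) := by
  set S := {x : EuclideanSpace ℝ (Fin d) | R - 1 < ‖x‖ ∧ ‖x‖ < R} with hS
  have hSm : MeasurableSet S :=
    ((isOpen_lt continuous_const continuous_norm).inter
      (isOpen_lt continuous_norm continuous_const)).measurableSet
  have hχ : ContDiff ℝ 2 (radialCutoff R : EuclideanSpace ℝ (Fin d) → ℝ) :=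
    contDiff_radialCutoff R
  have hχs : HasCompactSupport (radialCutoff R : EuclideanSpace ℝ (Fin d) → ℝ) :=
    hasCompactSupport_radialCutoff hR
  have hχc := hχ.continuous
  have huc := hu.continuous
  have hgC : ∀ l : ℂ →L[ℝ] ℝ, ContDiff ℝ 2 (fun y => radialCutoff R y * l (u y)) :=
    fun l => hχ.mul (l.contDiff.comp hu)
  have hgs : ∀ l : ℂ →L[ℝ] ℝ, HasCompactSupport (fun y => radialCutoff R y * l (u y)) :=
    fun l => hχs.mul_right
  have hexp : Continuous (fun x : EuclideanSpace ℝ (Fin d) =>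
    Real.exp (τ * (x i + 3 * R) ^ 2)) := by fun_prop
  have iLeft : ∀ l : ℂ →L[ℝ] ℝ, Integrable (fun x : EuclideanSpace ℝ (Fin d) =>
      Real.exp (τ * (x i + 3 * R) ^ 2) *
        ((x i + 3 * R) ^ 2 * (radialCutoff R x * l (u x)) ^ 2)) := by
    intro l
    refine Continuous.integrable_of_hasCompactSupport
      (hexp.mul (Continuous.mul (by fun_prop) ((hgC l).continuous.pow 2))) ?_
    exact (((hgs l).comp_left (g := fun t : ℝ => t ^ 2) (by norm_num)).mul_left).mul_left
  have iRight : ∀ l : ℂ →L[ℝ] ℝ, Integrable (fun x : EuclideanSpace ℝ (Fin d) =>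
      Real.exp (τ * (x i + 3 * R) ^ 2) * lap (fun y => radialCutoff R y * l (u y)) x ^ 2) := by
    intro l
    refine Continuous.integrable_of_hasCompactSupport
      (hexp.mul ((hgC l).continuous_lap.pow 2)) ?_
    exact ((hgs l).lap.comp_left (g := fun t : ℝ => t ^ 2) (by norm_num)).mul_left
  have iG : Integrable (fun x : EuclideanSpace ℝ (Fin d) =>
      Real.exp (τ * (x i + 3 * R) ^ 2) * (radialCutoff R x ^ 2 * ‖u x‖ ^ 2)) := by
    refine Continuous.integrable_of_hasCompactSupport (by fun_prop) ?_
    exact ((hχs.comp_left (g := fun t : ℝ => t ^ 2) (by norm_num)).mul_right).mul_left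
  have iA : Integrable (S.indicator fun x => ‖u x‖ ^ 2 + ‖fderiv ℝ u x‖ ^ 2) :=
    hint.indicator hSm
  have hlre : ‖Complex.reCLM‖ ≤ 1 := by simp
  have hlim : ‖Complex.imCLM‖ ≤ 1 := by simp
  have hre := carleman_inequality (hgC Complex.reCLM) (hgs _) i (3 * R) hτ
  have him := carleman_inequality (hgC Complex.imCLM) (hgs _) i (3 * R) hτ
  have hlow := integral_mono (iG.const_mul (4 * R ^ 2))
    ((iLeft Complex.reCLM).add (iLeft Complex.imCLM)) (fun x => by
      simp only [Pi.add_apply]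
      rw [← mul_add, ← mul_add, mul_pow, mul_pow, ← mul_add, ← sq_norm_eq_re_sq_add_im_sq,
        mul_left_comm]
      refine mul_le_mul_of_nonneg_left ?_ (Real.exp_nonneg _)
      rcases le_or_gt ‖x‖ R with hx | hx
      · exact mul_le_mul_of_nonneg_right (weight_mem_Icc hτ i hx).1 (by positivity)
      · simp [radialCutoff_eq_zero hR hx.le])
  have hup := integral_mono ((iRight Complex.reCLM).add (iRight Complex.imCLM))
    ((iG.const_mul (2 * L ^ 2)).add (iA.const_mul
      (Real.exp (16 * (τ * R ^ 2)) * (8 * ((4 + 2 * d) * M) ^ 2)))) (fun x => by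
      simp only [Pi.add_apply]
      have h1 := sq_lap_radialCutoff_mul_le hR hM hlre hu x
      have h2 := sq_lap_radialCutoff_mul_le hR hM hlim hu x
      rw [← hS] at h1 h2
      have h3 : Complex.reCLM (lapR u x) ^ 2 + Complex.imCLM (lapR u x) ^ 2 ≤
          L ^ 2 * ‖u x‖ ^ 2 := by
        rw [← sq_norm_eq_re_sq_add_im_sq, eq_neg_of_add_eq_zero_left (heq x), norm_neg, norm_mul,
          mul_pow]
        exact mul_le_mul_of_nonneg_right (pow_le_pow_left₀ (norm_nonneg _) (hV x) 2)
          (by positivity)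
      have h4 := mul_le_mul_of_nonneg_left h3 (sq_nonneg (radialCutoff R x))
      have hind : S.indicator
          (fun x => 4 * ((4 + 2 * d) * M) ^ 2 * (‖u x‖ ^ 2 + ‖fderiv ℝ u x‖ ^ 2)) x =
          4 * ((4 + 2 * d) * M) ^ 2 *
            S.indicator (fun x => ‖u x‖ ^ 2 + ‖fderiv ℝ u x‖ ^ 2) x := by
        simp [Set.indicator_apply]
      rw [hind] at h1 h2
      have h5 : Real.exp (τ * (x i + 3 * R) ^ 2) * (8 * ((4 + 2 * d) * M) ^ 2 *
            S.indicator (fun x => ‖u x‖ ^ 2 + ‖fderiv ℝ u x‖ ^ 2) x) ≤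
          Real.exp (16 * (τ * R ^ 2)) * (8 * ((4 + 2 * d) * M) ^ 2 *
            S.indicator (fun x => ‖u x‖ ^ 2 + ‖fderiv ℝ u x‖ ^ 2) x) := by
        by_cases hx : x ∈ S
        · rw [Set.indicator_of_mem hx]
          exact mul_le_mul_of_nonneg_right (weight_mem_Icc hτ i hx.2.le).2 (by positivity)
        · simp [Set.indicator_of_notMem hx]
      have h6 := mul_le_mul_of_nonneg_left
        (show _ ≤ _ from add_le_add h1 h2) (Real.exp_nonneg (τ * (x i + 3 * R) ^ 2))
      have h7 := mul_le_mul_of_nonneg_left h4 (Real.exp_nonneg (τ * (x i + 3 * R) ^ 2))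
      linarith)
  rw [integral_const_mul, integral_add' (iLeft _) (iLeft _)] at hlow
  rw [integral_add' (iRight _) (iRight _), integral_add' (iG.const_mul _) (iA.const_mul _),
    integral_const_mul, integral_const_mul, integral_indicator hSm] at hup
  have hlow' := mul_le_mul_of_nonneg_left hlow (show 0 ≤ 4 * τ ^ 3 by positivity)
  linarith

theorem one_le_weighted_integral {R τ : ℝ} (hR : 2 ≤ R) (hτ : 0 ≤ τ)
    {u : EuclideanSpace ℝ (Fin d) → ℂ} (hu : Continuous u)
    (hone : 1 ≤ ∫ x in {x : EuclideanSpace ℝ (Fin d) | ‖x‖ < 1}, ‖u x‖ ^ 2) (i : Fin d) :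
    1 ≤ ∫ x, Real.exp (τ * (x i + 3 * R) ^ 2) * (radialCutoff R x ^ 2 * ‖u x‖ ^ 2) := by
  have hχc := (contDiff_radialCutoff R : ContDiff ℝ 2
    (radialCutoff R : EuclideanSpace ℝ (Fin d) → ℝ)).continuous
  have hχs : HasCompactSupport (radialCutoff R : EuclideanSpace ℝ (Fin d) → ℝ) :=
    hasCompactSupport_radialCutoff (by linarith)
  have iG : Integrable (fun x : EuclideanSpace ℝ (Fin d) =>
      Real.exp (τ * (x i + 3 * R) ^ 2) * (radialCutoff R x ^ 2 * ‖u x‖ ^ 2)) := by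
    refine Continuous.integrable_of_hasCompactSupport (by fun_prop) ?_
    exact ((hχs.comp_left (g := fun t : ℝ => t ^ 2) (by norm_num)).mul_right).mul_left
  have hSm : MeasurableSet {x : EuclideanSpace ℝ (Fin d) | ‖x‖ < 1} :=
    (isOpen_lt continuous_norm continuous_const).measurableSet
  rw [← integral_indicator hSm] at hone
  refine hone.trans (integral_mono_of_nonneg
    (Filter.Eventually.of_forall fun x => Set.indicator_nonneg (fun _ _ => by positivity) x) iG
    (Filter.Eventually.of_forall fun x => ?_))
  by_cases hx : x ∈ {x : EuclideanSpace ℝ (Fin d) | ‖x‖ < 1}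
  · simp only [Set.indicator_of_mem hx]
    rw [radialCutoff_eq_one (by linarith)
      (show ‖x‖ ≤ R - 1 from (le_of_lt hx).trans (by linarith)), one_pow, one_mul]
    exact le_mul_of_one_le_left (by positivity) (Real.one_le_exp (by positivity))
  · simp only [Set.indicator_of_notMem hx]
    positivity

theorem exp_le_annulus_integral {R M L : ℝ} (hR : 2 ≤ R)
    (hM : ∀ t, |deriv Real.smoothTransition t| ≤ M ∧
      |deriv (deriv Real.smoothTransition) t| ≤ M)
    {u V : EuclideanSpace ℝ (Fin d) → ℂ} (hu : ContDiff ℝ 2 u)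
    (hint : Integrable (fun x => ‖u x‖ ^ 2 + ‖fderiv ℝ u x‖ ^ 2))
    (heq : ∀ x, lapR u x + V x * u x = 0) (hV : ∀ x, ‖V x‖ ≤ L)
    (hone : 1 ≤ ∫ x in {x : EuclideanSpace ℝ (Fin d) | ‖x‖ < 1}, ‖u x‖ ^ 2) (i : Fin d) :
    1 ≤ Real.exp (16 * ((2 * L ^ 2 + 1) * R ^ ((4 : ℝ) / 3))) *
        (8 * ((4 + 2 * d) * M) ^ 2) *
        ∫ x in {x : EuclideanSpace ℝ (Fin d) | R - 1 < ‖x‖ ∧ ‖x‖ < R},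
          (‖u x‖ ^ 2 + ‖fderiv ℝ u x‖ ^ 2) := by
  have hR0 : 0 < R := by linarith
  set K := 2 * L ^ 2 + 1 with hK
  have hK1 : 1 ≤ K := by nlinarith [sq_nonneg L]
  set τ := K * R ^ (-(2 : ℝ) / 3) with hτdef
  have hτ : 0 ≤ τ := by positivity
  have h2 : τ * R ^ 2 = K * R ^ ((4 : ℝ) / 3) := by
    rw [hτdef, mul_assoc, ← Real.rpow_natCast R 2, ← Real.rpow_add hR0]
    norm_num
  have h3 : τ ^ 3 * R ^ 2 = K ^ 3 := by
    rw [hτdef, mul_pow, mul_assoc, ← Real.rpow_natCast R 2, ← Real.rpow_natCast (R ^ _) 3,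
      ← Real.rpow_mul hR0.le, ← Real.rpow_add hR0]
    norm_num
  have hw := weighted_integral_le_annulus (show 1 ≤ R by linarith) hτ hM hu hint heq hV i
  have hG := one_le_weighted_integral hR hτ hu.continuous hone i
  rw [h2, h3] at hw
  refine le_trans ?_ hw
  have : 1 ≤ 16 * K ^ 3 - 2 * L ^ 2 := by
    have : K ≤ K ^ 3 := le_self_pow₀ hK1 (by norm_num)
    linarith
  exact one_le_mul_of_one_le_of_one_le this hG

end LowerBound

/-- **Lower bound for solutions to the continuous stationary problem.**
If `u ∈ H²(ℝ^d)` solves `Δu + Vu = 0` with `‖V‖_∞ ≤ L`, `∫_{|x|<1}|u|² ≥ 1` and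
`∫(|u|² + |∇u|²) ≤ A²`, then there is `c = c(L,A) > 0` such that for all sufficiently
large `R`, `λ(R) = (∫_{R-1<|x|<R}(|u|² + |∇u|²))^{1/2} ≥ c e^{-cR^{4/3}}`. -/
theorem lower_bound_continuous_elliptic (d : ℕ) (hd : 1 ≤ d) (L A : ℝ) :
    ∃ c : ℝ, 0 < c ∧ ∃ R₀ : ℝ, 0 < R₀ ∧
      ∀ u V : EuclideanSpace ℝ (Fin d) → ℂ,
        -- `u ∈ H²(ℝ^d)` solves `Δu + Vu = 0`
        ContDiff ℝ 2 u →
        Integrable (fun x => ‖u x‖ ^ 2 + ‖fderiv ℝ u x‖ ^ 2) →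
        (∀ x, lapR u x + V x * u x = 0) →
        -- `‖V‖_∞ ≤ L`
        (∀ x, ‖V x‖ ≤ L) →
        -- `∫_{|x|<1} |u|² ≥ 1`
        (1 ≤ ∫ x in {x : EuclideanSpace ℝ (Fin d) | ‖x‖ < 1}, ‖u x‖ ^ 2) →
        -- `∫ (|u|² + |∇u|²) ≤ A²`
        (∫ x : EuclideanSpace ℝ (Fin d), (‖u x‖ ^ 2 + ‖fderiv ℝ u x‖ ^ 2)) ≤ A ^ 2 →
        ∀ R : ℝ, R₀ ≤ R →
          c * Real.exp (-c * R ^ ((4 : ℝ) / 3)) ≤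
            Real.sqrt (∫ x in {x : EuclideanSpace ℝ (Fin d) | R - 1 < ‖x‖ ∧ ‖x‖ < R},
              (‖u x‖ ^ 2 + ‖fderiv ℝ u x‖ ^ 2)) := by
  obtain ⟨M, hM⟩ := exists_bound_deriv_smoothTransition
  set B : ℝ := 8 * ((4 + 2 * d) * M) ^ 2 with hB
  have hBn : 0 ≤ B := by positivity
  set c : ℝ := 8 * (2 * L ^ 2 + 1) + 1 with hc
  have hc0 : 0 < c := by positivity
  refine ⟨c, hc0, max 2 (c ^ 2 * B), by positivity, ?_⟩
  intro u V hu hint heq hV hone _ R hR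
  have hR2 : 2 ≤ R := (le_max_left _ _).trans hR
  have hRB : c ^ 2 * B ≤ R := (le_max_right _ _).trans hR
  have h := exp_le_annulus_integral hR2 hM hu hint heq hV hone ⟨0, hd⟩
  rw [← hB] at h
  set I := ∫ x in {x : EuclideanSpace ℝ (Fin d) | R - 1 < ‖x‖ ∧ ‖x‖ < R},
    (‖u x‖ ^ 2 + ‖fderiv ℝ u x‖ ^ 2)
  have hI : 0 ≤ I := integral_nonneg fun x => by positivity
  set T := R ^ ((4 : ℝ) / 3) with hT
  have hRT : R ≤ T := by
    simpa using Real.rpow_le_rpow_of_exponent_le (show 1 ≤ R by linarith)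
      (show (1 : ℝ) ≤ 4 / 3 by norm_num)
  refine Real.le_sqrt_of_sq_le ?_
  have hexp : c ^ 2 * B ≤ Real.exp (2 * T) := by
    have := Real.add_one_le_exp (2 * T)
    linarith
  have hsplit : Real.exp (16 * ((2 * L ^ 2 + 1) * T)) * Real.exp (2 * T) * Real.exp (-c * T) ^ 2
      = 1 := by
    rw [← Real.exp_nat_mul, ← Real.exp_add, ← Real.exp_add, Real.exp_eq_one_iff, hc]
    push_cast
    ring
  calc (c * Real.exp (-c * T)) ^ 2 = c ^ 2 * Real.exp (-c * T) ^ 2 * 1 := by ring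
    _ ≤ c ^ 2 * Real.exp (-c * T) ^ 2 *
        (Real.exp (16 * ((2 * L ^ 2 + 1) * T)) * B * I) :=
      mul_le_mul_of_nonneg_left h (by positivity)
    _ = c ^ 2 * B * (Real.exp (-c * T) ^ 2 * Real.exp (16 * ((2 * L ^ 2 + 1) * T)) * I) := by ring
    _ ≤ Real.exp (2 * T) * (Real.exp (-c * T) ^ 2 *
        Real.exp (16 * ((2 * L ^ 2 + 1) * T)) * I) :=
      mul_le_mul_of_nonneg_right hexp (by positivity)
    _ = Real.exp (16 * ((2 * L ^ 2 + 1) * T)) * Real.exp (2 * T) * Real.exp (-c * T) ^ 2 * I := by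
      ring
    _ = I := by rw [hsplit, one_mul]
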